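/- A U(g_E)-module M belongs to category O^∞ if and only if there is a finite filtration 0 = M_0 ⊆ M_1 ⊆ … ⊆ M_n = M by U(g_E)-submodules such that every quotient M_k/M_{k−1}, 1 ≤ k ≤ n, lies in category O. -/

import Mathlib

noncomputable section

namespace PaperO

variable (E : Type) [Field E]
variable (g : Type) [LieRing g] [LieAlgebra E g]
variable (t b : LieSubalgebra E g)

section WeightTheory

variable (M : Type) [AddCommGroup M] [Module E M] [LieRingModule g M] [LieModule E g M]

/-- `M^i_χ`: the subspace of all `m` with `(h - χ(h))^i • m = 0` for all `h ∈ t`. -/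
def wsp (i : ℕ) (χ : Module.Dual E ↥t) : Submodule E M :=
  ⨅ h : ↥t, LinearMap.ker ((LieModule.toEnd E g M (h : g) - χ h • (1 : Module.End E M)) ^ i)

/-- The generalized weight space `M^∞_χ = ⋃ i, M^i_χ`. -/
def gwsp (χ : Module.Dual E ↥t) : Submodule E M := ⨆ i : ℕ, wsp E g t M i χ

/-- The set of weights `Π(M)` of `M`. -/
def weights : Set (Module.Dual E ↥t) := {χ | gwsp E g t M χ ≠ ⊥}

/-- `M` is `E`-split: it is the direct sum of its generalized weight spaces. -/
def IsESplit : Prop :=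
  letI : DecidableEq (Module.Dual E ↥t) := Classical.decEq _
  DirectSum.IsInternal (fun χ : Module.Dual E ↥t => gwsp E g t M χ)

/-- `M` is diagonalizable: it is the direct sum of its weight spaces. -/
def IsDiagonalizable : Prop :=
  letI : DecidableEq (Module.Dual E ↥t) := Classical.decEq _
  DirectSum.IsInternal (fun χ : Module.Dual E ↥t => wsp E g t M 1 χ)

/-- The action of `b` on `M` is locally finite: every `m ∈ M` lies in a
finite-dimensional `b`-stable subspace (equivalently, `U(b)·m` is finite-dimensional). -/
def IsLocBFinite : Prop :=
  ∀ m : M, ∃ W : Submodule E M, FiniteDimensional E ↥W ∧ m ∈ W ∧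
    ∀ x : ↥b, ∀ w ∈ W, ⁅(x : g), w⁆ ∈ W

/-- `M` is finitely generated as a `U(g)`-module (equivalently, as a Lie module). -/
def IsFG : Prop := ∃ S : Finset M, LieSubmodule.lieSpan E g (S : Set M) = ⊤

/-- Membership in the BGG category `O` for `(g, b, t)`. -/
def InCatO : Prop := IsFG E g M ∧ IsDiagonalizable E g t M ∧ IsLocBFinite E g b M

/-- Membership in the thick category `O^∞` for `(g, b, t)`. -/
def InCatOInf : Prop := IsFG E g M ∧ IsESplit E g t M ∧ IsLocBFinite E g b M

variable (Λ : AddSubgroup (Module.Dual E ↥t))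

/-- All weights of `M` are algebraic, i.e. lie in the subgroup `Λ ⊆ t*` which is
the image of the derivative map `d : X*(T) → t*`. -/
def IsAlgWt : Prop := ∀ χ ∈ weights E g t M, χ ∈ Λ

/-- Membership in the category `O_alg`. -/
def InCatOAlg : Prop := InCatO E g t b M ∧ IsAlgWt E g t M Λ

/-- Membership in the category `O^∞_alg`. -/
def InCatOInfAlg : Prop := InCatOInf E g t b M ∧ IsAlgWt E g t M Λ

end WeightTheory

/-- The root space `g_α` for a linear form `α` on `t`. -/
def rootSp (α : Module.Dual E ↥t) : Submodule E g :=
  ⨅ h : ↥t, LinearMap.ker (((LieAlgebra.ad E g) (h : g) - α h • (1 : Module.End E g)))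

/-- The subquotient `c (k+1) / c k` of a filtration by Lie submodules. -/
abbrev filtQuot {E : Type} [Field E] {g : Type} [LieRing g] [LieAlgebra E g]
    {M : Type} [AddCommGroup M] [Module E M] [LieRingModule g M] [LieModule E g M]
    (c : ℕ → LieSubmodule E g M) (k : ℕ) :=
  (↥(c (k + 1))) ⧸ (LieSubmodule.comap (c (k + 1)).incl (c k))

section LinearAlgebra

open Polynomial

variable {E V V' : Type*} [Field E] [AddCommGroup V] [Module E V] [AddCommGroup V'] [Module E V']

lemma map_pow_apply_of_intertwines (f : V →ₗ[E] V') (T : Module.End E V) (T' : Module.End E V')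
    (h : ∀ v, f (T v) = T' (f v)) (n : ℕ) (v : V) : f ((T ^ n) v) = (T' ^ n) (f v) := by
  induction n generalizing v with
  | zero => simp
  | succ n ih => rw [pow_succ, pow_succ, Module.End.mul_apply, Module.End.mul_apply, ih, h]

lemma map_aeval_apply_of_intertwines (f : V →ₗ[E] V') (T : Module.End E V) (T' : Module.End E V')
    (h : ∀ v, f (T v) = T' (f v)) (p : E[X]) (v : V) :
    f (aeval T p v) = aeval T' p (f v) := by
  induction p using Polynomial.induction_on' with
  | add p q hp hq => simp [hp, hq]
  | monomial n a =>
    simp [aeval_monomial, Module.algebraMap_end_apply, map_pow_apply_of_intertwines f T T' h]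

lemma exists_mem_maxGenEigenspace_sub_apply_eq (T : Module.End E V) {a μ : E} (hμ : μ ≠ a)
    (k : ℕ) (x : V) (hx : ((T - μ • (1 : Module.End E V)) ^ k) x = 0) :
    ∃ y ∈ T.maxGenEigenspace μ, (T - a • (1 : Module.End E V)) y = x := by
  induction k generalizing x with
  | zero => exact ⟨0, zero_mem _, by simpa using hx.symm⟩
  | succ k ih =>
    obtain ⟨y, hy, hyx⟩ := ih ((T - μ • (1 : Module.End E V)) x)
      (by rwa [pow_succ, Module.End.mul_apply] at hx)
    have hne : μ - a ≠ 0 := sub_ne_zero.mpr hμ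
    refine ⟨(μ - a)⁻¹ • (x - y), Submodule.smul_mem _ _ (Submodule.sub_mem _ ?_ hy), ?_⟩
    · exact (T.mem_maxGenEigenspace μ x).mpr ⟨_, hx⟩
    · rw [map_smul, map_sub, hyx, inv_smul_eq_iff₀ hne]
      simp only [LinearMap.sub_apply, LinearMap.smul_apply, Module.End.one_apply, sub_smul]
      abel

lemma mem_iSup_maxGenEigenspace_of_sub_apply_mem (T : Module.End E V) (a : E) (m : V)
    (hm : (T - a • (1 : Module.End E V)) m ∈ ⨆ μ, T.maxGenEigenspace μ) :
    m ∈ ⨆ μ, T.maxGenEigenspace μ := by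
  have key : ⨆ μ, T.maxGenEigenspace μ ≤
      (⨆ μ, T.maxGenEigenspace μ).map (T - a • (1 : Module.End E V)) ⊔ T.maxGenEigenspace a := by
    refine iSup_le fun μ => ?_
    by_cases hμ : μ = a
    · subst hμ; exact le_sup_right
    · intro x hx
      obtain ⟨k, hk⟩ := (T.mem_maxGenEigenspace μ x).mp hx
      obtain ⟨y, hy, rfl⟩ := exists_mem_maxGenEigenspace_sub_apply_eq T hμ k x hk
      exact Submodule.mem_sup_left (Submodule.mem_map_of_mem (Submodule.mem_iSup_of_mem μ hy))
  obtain ⟨_, ⟨y, hy, rfl⟩, z, hz, hyz⟩ := Submodule.mem_sup.mp (key hm)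
  obtain ⟨k, hk⟩ := (T.mem_maxGenEigenspace a z).mp hz
  have hmy : m - y ∈ T.maxGenEigenspace a := by
    refine (T.mem_maxGenEigenspace a _).mpr ⟨k + 1, ?_⟩
    rw [pow_succ, Module.End.mul_apply, map_sub, ← hyz, add_sub_cancel_left, hk]
  have := Submodule.add_mem _ (Submodule.mem_iSup_of_mem a hmy) hy
  rwa [sub_add_cancel] at this

lemma mem_iSup_maxGenEigenspace_of_aeval_prod_eq_zero (T : Module.End E V) (s : Multiset E)
    (m : V) (hm : aeval T (s.map fun a => X - C a).prod m = 0) :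
    m ∈ ⨆ μ, T.maxGenEigenspace μ := by
  induction s using Multiset.induction_on generalizing m with
  | empty => simp at hm; simp [hm]
  | cons a s ih =>
    refine mem_iSup_maxGenEigenspace_of_sub_apply_mem T a m (ih _ ?_)
    rw [Multiset.map_cons, Multiset.prod_cons, mul_comm, map_mul, Module.End.mul_apply] at hm
    simpa [Algebra.algebraMap_eq_smul_one] using hm

lemma exists_fg_map_eq_of_surjective (f : V →ₗ[E] V') (hf : Function.Surjective f)
    (W : Submodule E V') (hW : W.FG) : ∃ U : Submodule E V, U.FG ∧ U.map f = W := by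
  classical
  obtain ⟨s, rfl⟩ := hW
  refine ⟨Submodule.span E (s.image (Function.surjInv hf) : Finset V), ⟨_, rfl⟩, ?_⟩
  rw [Submodule.map_span, Finset.coe_image, Set.image_image]
  simp [Function.surjInv_eq]

end LinearAlgebra

section LieModules

variable {E : Type} [Field E] {g : Type} [LieRing g] [LieAlgebra E g]
  {t b : LieSubalgebra E g}
  {M : Type} [AddCommGroup M] [Module E M] [LieRingModule g M] [LieModule E g M]
  {N : Type} [AddCommGroup N] [Module E N] [LieRingModule g N] [LieModule E g N]

omit [LieAlgebra E g] [LieModule E g M] [LieModule E g N] in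
lemma map_lieSpan (f : M →ₗ⁅E,g⁆ N) (s : Set M) :
    (LieSubmodule.lieSpan E g s).map f = LieSubmodule.lieSpan E g (f '' s) := by
  apply le_antisymm
  · rw [LieSubmodule.map_le_iff_le_comap, LieSubmodule.lieSpan_le]
    exact fun x hx => LieSubmodule.subset_lieSpan ⟨x, hx, rfl⟩
  · rw [LieSubmodule.lieSpan_le]
    rintro _ ⟨x, hx, rfl⟩
    exact LieSubmodule.mem_map_of_mem (LieSubmodule.subset_lieSpan hx)

omit [LieAlgebra E g] [LieModule E g M] [LieModule E g N] in
lemma exists_lieSpan_eq_map (f : M →ₗ⁅E,g⁆ N) {P : LieSubmodule E g M}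
    (hP : ∃ s : Finset M, LieSubmodule.lieSpan E g (s : Set M) = P) :
    ∃ s : Finset N, LieSubmodule.lieSpan E g (s : Set N) = P.map f := by
  classical
  obtain ⟨s, rfl⟩ := hP
  exact ⟨s.image f, by rw [map_lieSpan, Finset.coe_image]⟩

omit [LieAlgebra E g] [LieModule E g M] in
lemma isFG_coe_iff (P : LieSubmodule E g M) :
    IsFG E g ↥P ↔ ∃ s : Finset M, LieSubmodule.lieSpan E g (s : Set M) = P := by
  classical
  constructor
  · intro h
    simpa using exists_lieSpan_eq_map P.incl h
  · rintro ⟨s, hs⟩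
    have hsP : ∀ x ∈ s, x ∈ P := fun x hx => hs ▸ LieSubmodule.subset_lieSpan hx
    refine ⟨s.attach.image fun x => ⟨x.1, hsP x.1 x.2⟩, ?_⟩
    apply LieSubmodule.map_injective_of_injective P.injective_incl
    rw [map_lieSpan, LieSubmodule.map_incl_top]
    refine Eq.trans (congrArg _ ?_) hs
    ext x
    simp only [Finset.coe_image, Finset.coe_attach, Set.image_univ]
    constructor
    · rintro ⟨_, ⟨y, rfl⟩, rfl⟩; exact y.2
    · exact fun hx => ⟨_, ⟨⟨x, hx⟩, rfl⟩, rfl⟩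

omit [LieAlgebra E g] [LieModule E g M] [LieModule E g N] in
lemma isFG_of_surjective (f : M →ₗ⁅E,g⁆ N) (hf : Function.Surjective f) (h : IsFG E g M) :
    IsFG E g N := by
  obtain ⟨s, hs⟩ := exists_lieSpan_eq_map f h
  refine ⟨s, ?_⟩
  rw [hs, LieModuleHom.map_top, LieModuleHom.range_eq_top]
  exact hf

omit [LieModule E g M] [LieModule E g N] in
lemma isLocBFinite_of_surjective (f : M →ₗ⁅E,g⁆ N) (hf : Function.Surjective f)
    (h : IsLocBFinite E g b M) : IsLocBFinite E g b N := by
  intro n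
  obtain ⟨m, rfl⟩ := hf n
  obtain ⟨W, hW, hm, hb⟩ := h m
  refine ⟨W.map (f : M →ₗ[E] N), inferInstance, ⟨m, hm, rfl⟩, ?_⟩
  rintro x _ ⟨w, hw, rfl⟩
  exact ⟨_, hb x w hw, by simp⟩

omit [LieModule E g M] in
lemma isLocBFinite_coe (P : LieSubmodule E g M) (h : IsLocBFinite E g b M) :
    IsLocBFinite E g b ↥P := by
  intro m
  obtain ⟨W, hW, hm, hb⟩ := h m
  refine ⟨W.comap P.toSubmodule.subtype, ?_, hm, fun x w hw => hb x _ hw⟩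
  have : Function.Injective (P.toSubmodule.subtype.restrict (p := W.comap P.toSubmodule.subtype)
      (q := W) fun x hx => hx) := by
    intro x y hxy
    have hval := congrArg Subtype.val hxy
    exact Subtype.ext (Subtype.ext hval)
  exact Module.Finite.of_injective _ this

omit [LieModule E g M] in
/-- Finite sets of `b`-finite vectors span a common finite-dimensional `b`-stable subspace. -/
lemma exists_stable_ge_of_fg {F : Submodule E M} (hF : F.FG)
    (h : ∀ m ∈ F, ∃ W : Submodule E M, FiniteDimensional E ↥W ∧ m ∈ W ∧
      ∀ x : ↥b, ∀ w ∈ W, ⁅(x : g), w⁆ ∈ W) :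
    ∃ W : Submodule E M, FiniteDimensional E ↥W ∧ F ≤ W ∧
      ∀ x : ↥b, ∀ w ∈ W, ⁅(x : g), w⁆ ∈ W := by
  induction F, hF using Submodule.fg_induction with
  | singleton m =>
    obtain ⟨W, hW, hm, hb⟩ := h m (Submodule.mem_span_singleton_self m)
    exact ⟨W, hW, by simpa using hm, hb⟩
  | sup F₁ F₂ _ _ h₁ h₂ =>
    obtain ⟨W₁, _, hF₁, hb₁⟩ := h₁ fun m hm => h m (Submodule.mem_sup_left hm)
    obtain ⟨W₂, _, hF₂, hb₂⟩ := h₂ fun m hm => h m (Submodule.mem_sup_right hm)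
    refine ⟨W₁ ⊔ W₂, inferInstance, sup_le_sup hF₁ hF₂, fun x w hw => ?_⟩
    obtain ⟨w₁, hw₁, w₂, hw₂, rfl⟩ := Submodule.mem_sup.mp hw
    rw [lie_add]
    exact Submodule.add_mem_sup (hb₁ x _ hw₁) (hb₂ x _ hw₂)

lemma mem_wsp {i : ℕ} {χ : Module.Dual E ↥t} {m : M} :
    m ∈ wsp E g t M i χ ↔
      ∀ h : ↥t, ((LieModule.toEnd E g M (h : g) - χ h • (1 : Module.End E M)) ^ i) m = 0 := by
  simp [wsp]

lemma mem_wsp_one {χ : Module.Dual E ↥t} {m : M} :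
    m ∈ wsp E g t M 1 χ ↔ ∀ h : ↥t, ⁅(h : g), m⁆ = χ h • m := by
  simp [mem_wsp, sub_eq_zero]

lemma wsp_mono (χ : Module.Dual E ↥t) : Monotone fun i => wsp E g t M i χ := by
  intro i j hij m hm
  rw [mem_wsp] at hm ⊢
  exact fun h => Module.End.pow_map_zero_of_le hij (hm h)

lemma mem_gwsp {χ : Module.Dual E ↥t} {m : M} :
    m ∈ gwsp E g t M χ ↔ ∃ i, m ∈ wsp E g t M i χ :=
  Submodule.mem_iSup_of_directed _ (wsp_mono χ).directed_le

lemma wsp_le_gwsp (i : ℕ) (χ : Module.Dual E ↥t) : wsp E g t M i χ ≤ gwsp E g t M χ :=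
  le_iSup (fun i => wsp E g t M i χ) i

lemma gwsp_le_iInf_maxGenEigenspace (χ : Module.Dual E ↥t) :
    gwsp E g t M χ ≤ ⨅ h : ↥t, (LieModule.toEnd E g M (h : g)).maxGenEigenspace (χ h) := by
  intro m hm
  obtain ⟨i, hi⟩ := mem_gwsp.mp hm
  rw [Submodule.mem_iInf]
  exact fun h => (Module.End.mem_maxGenEigenspace _ _ _).mpr ⟨i, mem_wsp.mp hi h⟩

lemma lie_coe_eq_zero [IsLieAbelian ↥t] (h h' : ↥t) : ⁅(h : g), (h' : g)⁆ = 0 := by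
  rw [← LieSubalgebra.coe_bracket, trivial_lie_zero, ZeroMemClass.coe_zero]

lemma commute_toEnd [IsLieAbelian ↥t] (h h' : ↥t) :
    Commute (LieModule.toEnd E g M (h : g)) (LieModule.toEnd E g M (h' : g)) := by
  ext m
  simp [leibniz_lie (h : g) (h' : g) m, lie_coe_eq_zero]

variable (t M) in
lemma iSupIndep_gwsp [IsLieAbelian ↥t] : iSupIndep fun χ => gwsp E g t M χ := by
  have h := Module.End.independent_iInf_maxGenEigenspace_of_forall_mapsTo
    (fun h : ↥t => LieModule.toEnd E g M (h : g))
    fun i j φ => Module.End.mapsTo_maxGenEigenspace_of_comm (commute_toEnd j i) φ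
  exact (h.comp (f := fun χ : Module.Dual E ↥t => (χ : ↥t → E)) DFunLike.coe_injective).mono
    gwsp_le_iInf_maxGenEigenspace

lemma isESplit_iff [IsLieAbelian ↥t] : IsESplit E g t M ↔ ⨆ χ, gwsp E g t M χ = ⊤ := by
  classical
  rw [IsESplit, DirectSum.isInternal_submodule_iff_iSupIndep_and_iSup_eq_top]
  exact and_iff_right (iSupIndep_gwsp t M)

lemma isDiagonalizable_iff [IsLieAbelian ↥t] :
    IsDiagonalizable E g t M ↔ ⨆ χ, wsp E g t M 1 χ = ⊤ := by
  classical
  rw [IsDiagonalizable, DirectSum.isInternal_submodule_iff_iSupIndep_and_iSup_eq_top]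
  exact and_iff_right ((iSupIndep_gwsp t M).mono fun χ => wsp_le_gwsp 1 χ)

lemma map_mem_gwsp (f : M →ₗ⁅E,g⁆ N) {χ : Module.Dual E ↥t} {m : M}
    (hm : m ∈ gwsp E g t M χ) : f m ∈ gwsp E g t N χ := by
  obtain ⟨i, hi⟩ := mem_gwsp.mp hm
  refine mem_gwsp.mpr ⟨i, mem_wsp.mpr fun h => ?_⟩
  have := map_pow_apply_of_intertwines (f : M →ₗ[E] N)
    (LieModule.toEnd E g M (h : g) - χ h • (1 : Module.End E M))
    (LieModule.toEnd E g N (h : g) - χ h • (1 : Module.End E N)) (by simp) i m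
  rw [mem_wsp.mp hi h, map_zero] at this
  exact this.symm

lemma lie_eq_of_mem_rootSp {α : Module.Dual E ↥t} {x : g} (hx : x ∈ rootSp E g t α) (h : ↥t) :
    ⁅(h : g), x⁆ = α h • x := by
  have := (Submodule.mem_iInf _).mp hx h
  simpa [sub_eq_zero] using this

lemma lie_mem_gwsp {α χ : Module.Dual E ↥t} {x : g} (hx : x ∈ rootSp E g t α) {m : M}
    (hm : m ∈ gwsp E g t M χ) : ⁅x, m⁆ ∈ gwsp E g t M (χ + α) := by
  obtain ⟨i, hi⟩ := mem_gwsp.mp hm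
  refine mem_gwsp.mpr ⟨i, mem_wsp.mpr fun h => ?_⟩
  have := map_pow_apply_of_intertwines (LieModule.toEnd E g M x)
    (LieModule.toEnd E g M (h : g) - χ h • (1 : Module.End E M))
    (LieModule.toEnd E g M (h : g) - (χ + α) h • (1 : Module.End E M))
    (fun v => by
      simp [leibniz_lie (h : g) x v, lie_eq_of_mem_rootSp hx h, add_smul]
      abel) i m
  rw [mem_wsp.mp hi h, map_zero] at this
  exact this.symm

lemma toSubmodule_le_rootSp_zero [IsLieAbelian ↥t] : t.toSubmodule ≤ rootSp E g t 0 := by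
  intro x hx
  refine (Submodule.mem_iInf _).mpr fun h => ?_
  simpa using lie_coe_eq_zero h ⟨x, hx⟩


lemma exists_semisimple_part (hM : IsESplit E g t M) :
    ∃ s : ↥t → Module.End E M, ∀ χ, ∀ m ∈ gwsp E g t M χ, ∀ h, s h m = χ h • m := by
  let : DecidableEq (Module.Dual E ↥t) := Classical.decEq _
  let e := LinearEquiv.ofBijective (DirectSum.coeLinearMap fun χ => gwsp E g t M χ) hM
  refine ⟨fun h => DirectSum.toModule E _ M (fun χ => χ h • (gwsp E g t M χ).subtype) ∘ₗ
    e.symm.toLinearMap, fun χ m hm h => ?_⟩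
  have he : e.symm m = DirectSum.lof E _ (fun χ => gwsp E g t M χ) χ ⟨m, hm⟩ := by
    rw [LinearEquiv.symm_apply_eq]
    exact (DirectSum.coeLinearMap_lof (fun χ => gwsp E g t M χ) χ ⟨m, hm⟩).symm
  simp [he]

lemma exists_nilpotent_part [IsLieAbelian ↥t] (hroot : ⨆ α, rootSp E g t α = ⊤)
    (hM : IsESplit E g t M) :
    ∃ n : ↥t → M →ₗ⁅E,g⁆ M, ∀ χ, ∀ m ∈ gwsp E g t M χ, ∀ h : ↥t,
      n h m = ⁅(h : g), m⁆ - χ h • m := by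
  obtain ⟨s, hs⟩ := exists_semisimple_part hM
  have hn (h : ↥t) (x : g) (m : M) : (LieModule.toEnd E g M (h : g) - s h) ⁅x, m⁆ =
      ⁅x, (LieModule.toEnd E g M (h : g) - s h) m⁆ := by
    have hx : x ∈ ⨆ α, rootSp E g t α := hroot ▸ Submodule.mem_top
    have hm : m ∈ ⨆ χ, gwsp E g t M χ := isESplit_iff.mp hM ▸ Submodule.mem_top
    induction hx using Submodule.iSup_induction' with
    | zero => simp
    | add x y _ _ hx hy => simp only [add_lie, map_add, hx, hy]
    | mem α x hx =>
      induction hm using Submodule.iSup_induction' with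
      | zero => simp
      | add m m' _ _ hm hm' => simp only [lie_add, map_add, hm, hm']
      | mem χ m hm =>
        simp [hs _ _ (lie_mem_gwsp hx hm), hs _ _ hm, leibniz_lie (h : g) x m,
          lie_eq_of_mem_rootSp hx h, add_smul]
        abel
  exact ⟨fun h => { LieModule.toEnd E g M (h : g) - s h with map_lie' := hn h _ _ },
    fun χ m hm h => by simp [← hs χ m hm h]⟩

section NilpotentPart

variable {n : ↥t → M →ₗ⁅E,g⁆ M}
  (hn : ∀ χ, ∀ m ∈ gwsp E g t M χ, ∀ h : ↥t, n h m = ⁅(h : g), m⁆ - χ h • m)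

include hn

lemma nilpotent_part_commute [IsLieAbelian ↥t] (hM : IsESplit E g t M) (h h' : ↥t) :
    Commute (n h : Module.End E M) (n h' : Module.End E M) := by
  refine LinearMap.ext fun m => ?_
  have hm : m ∈ ⨆ χ, gwsp E g t M χ := isESplit_iff.mp hM ▸ Submodule.mem_top
  change n h (n h' m) = n h' (n h m)
  induction hm using Submodule.iSup_induction' with
  | zero => simp
  | add m m' _ _ hm hm' => simp only [map_add, hm, hm']
  | mem χ m hm =>
    rw [hn χ m hm h', map_sub, map_smul, LieModuleHom.map_lie,
      hn χ (n h m) (map_mem_gwsp _ hm) h']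

lemma nilpotent_part_pow_apply {χ : Module.Dual E ↥t} {m : M} (hm : m ∈ gwsp E g t M χ)
    (h : ↥t) (i : ℕ) : ((n h : Module.End E M) ^ i) m =
      ((LieModule.toEnd E g M (h : g) - χ h • (1 : Module.End E M)) ^ i) m := by
  induction i generalizing m with
  | zero => simp
  | succ i ih =>
    rw [pow_succ, pow_succ, Module.End.mul_apply, Module.End.mul_apply]
    have : (LieModule.toEnd E g M (h : g) - χ h • (1 : Module.End E M)) m = n h m := by
      simp [hn χ m hm h]
    rw [this]
    exact ih (map_mem_gwsp _ hm)

lemma nilpotent_part_isNilpotent [IsLieAbelian ↥t] (hM : IsESplit E g t M) (hfg : IsFG E g M)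
    (h : ↥t) : IsNilpotent (n h : Module.End E M) := by
  have hloc (m : M) : ∃ k, ((n h : Module.End E M) ^ k) m = 0 := by
    have hm : m ∈ ⨆ χ, gwsp E g t M χ := isESplit_iff.mp hM ▸ Submodule.mem_top
    induction hm using Submodule.iSup_induction' with
    | zero => exact ⟨0, by simp⟩
    | add m m' _ _ hm hm' =>
      obtain ⟨k, hk⟩ := hm
      obtain ⟨l, hl⟩ := hm'
      exact ⟨k ⊔ l, by rw [map_add, Module.End.pow_map_zero_of_le le_sup_left hk,
        Module.End.pow_map_zero_of_le le_sup_right hl, add_zero]⟩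
    | mem χ m hm =>
      obtain ⟨i, hi⟩ := mem_gwsp.mp hm
      exact ⟨i, by rw [nilpotent_part_pow_apply hn hm, mem_wsp.mp hi h]⟩
  choose k hk using hloc
  obtain ⟨s, hs⟩ := hfg
  let K : LieSubmodule E g M :=
    { LinearMap.ker ((n h : Module.End E M) ^ s.sup k) with
      lie_mem := by
        intro x m hm
        have := map_pow_apply_of_intertwines (LieModule.toEnd E g M x) (n h : Module.End E M)
          (n h : Module.End E M) (by simp) (s.sup k) m
        change ((n h : Module.End E M) ^ s.sup k) m = 0 at hm
        change ((n h : Module.End E M) ^ s.sup k) ⁅x, m⁆ = 0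
        rw [hm, map_zero] at this
        exact this.symm }
  have hK : LieSubmodule.lieSpan E g (s : Set M) ≤ K := LieSubmodule.lieSpan_le.mpr
    fun m hm => Module.End.pow_map_zero_of_le (Finset.le_sup hm) (hk m)
  exact ⟨s.sup k, LinearMap.ext fun m => (hs ▸ hK) (LieSubmodule.mem_top m)⟩

end NilpotentPart

open scoped IsMulCommutative in
omit [LieAlgebra E g] [LieModule E g M] in
/-- A finite set of commuting nilpotent endomorphisms generates a nilpotent ideal. -/
lemma exists_descending_eq_bot {ι : Type*} (n : ι → M →ₗ⁅E,g⁆ M) (S : Finset ι)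
    (hcomm : ∀ i j, Commute (n i : Module.End E M) (n j : Module.End E M))
    (hnil : ∀ i, IsNilpotent (n i : Module.End E M)) (D : ℕ → LieSubmodule E g M)
    (hD : ∀ k, D (k + 1) = ⨆ i : S, (D k).map (n i)) : ∃ k, D k = ⊥ := by
  classical
  let X : Set (Module.End E M) := Set.range fun i => (n i : Module.End E M)
  have hX : ∀ a ∈ X, ∀ c ∈ X, a * c = c * a := by
    rintro _ ⟨i, rfl⟩ _ ⟨j, rfl⟩
    exact hcomm i j
  have := Algebra.isMulCommutative_adjoin E hX
  let y (i : ι) : Algebra.adjoin E X := ⟨n i, Algebra.subset_adjoin ⟨i, rfl⟩⟩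
  let I : Ideal (Algebra.adjoin E X) := Ideal.span (S.image y : Finset _)
  have hI : IsNilpotent I := by
    rw [Ideal.FG.isNilpotent_iff_le_nilradical ⟨_, rfl⟩, Ideal.span_le]
    intro z hz
    obtain ⟨i, -, rfl⟩ := Finset.mem_image.mp hz
    obtain ⟨k, hk⟩ := hnil i
    exact mem_nilradical.mpr ⟨k, Subtype.ext (by simpa [y] using hk)⟩
  have hDI (k : ℕ) : (D k).toSubmodule ≤
      Submodule.span E {m | ∃ a ∈ I ^ k, ∃ v : M, (a : Module.End E M) v = m} := by
    induction k with
    | zero => exact fun m _ => Submodule.subset_span ⟨1, by simp, m, by simp⟩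
    | succ k ih =>
      rw [hD, LieSubmodule.iSup_toSubmodule, iSup_le_iff]
      intro i
      rw [LieSubmodule.toSubmodule_map]
      refine (Submodule.map_mono ih).trans ?_
      rw [Submodule.map_span, Submodule.span_le]
      rintro _ ⟨_, ⟨a, ha, v, rfl⟩, rfl⟩
      refine Submodule.subset_span ⟨y i * a, ?_, v, rfl⟩
      rw [pow_succ']
      exact Ideal.mul_mem_mul (Ideal.subset_span (Finset.mem_image_of_mem y i.2)) ha
  obtain ⟨k, hk⟩ := hI
  refine ⟨k, ?_⟩
  rw [← LieSubmodule.toSubmodule_eq_bot, eq_bot_iff]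
  refine (hDI k).trans (Submodule.span_le.mpr ?_)
  rintro _ ⟨a, ha, v, rfl⟩
  rw [hk] at ha
  rw [show a = 0 from ha]
  simp

omit [LieAlgebra E g] [LieModule E g M] in
lemma exists_lieSpan_eq_iSup {ι : Type*} [Finite ι] {P : ι → LieSubmodule E g M}
    (h : ∀ i, ∃ s : Finset M, LieSubmodule.lieSpan E g (s : Set M) = P i) :
    ∃ s : Finset M, LieSubmodule.lieSpan E g (s : Set M) = ⨆ i, P i := by
  classical
  have := Fintype.ofFinite ι
  choose s hs using h
  refine ⟨Finset.univ.biUnion s, ?_⟩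
  simp [LieSubmodule.span_iUnion, hs]

lemma isDiagonalizable_subquotient [IsLieAbelian ↥t] (P P' : LieSubmodule E g M)
    (hP : P.toSubmodule ≤ ⨆ χ, P.toSubmodule ⊓ gwsp E g t M χ)
    (hPP' : ∀ χ, ∀ m ∈ P.toSubmodule ⊓ gwsp E g t M χ, ∀ h : ↥t,
      ⁅(h : g), m⁆ - χ h • m ∈ P') :
    IsDiagonalizable E g t (↥P ⧸ P'.comap P.incl) := by
  set π := LieSubmodule.Quotient.mk' (P'.comap P.incl)
  rw [isDiagonalizable_iff, eq_top_iff]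
  intro q _
  obtain ⟨m, rfl⟩ := LieSubmodule.Quotient.surjective_mk' _ q
  have key : ⨆ χ, P.toSubmodule ⊓ gwsp E g t M χ ≤
      ((⨆ χ, wsp E g t (↥P ⧸ P'.comap P.incl) 1 χ).comap (π : ↥P →ₗ[E] _)).map
        P.toSubmodule.subtype := by
    refine iSup_le fun χ m hm => ⟨⟨m, hm.1⟩, ?_, rfl⟩
    refine Submodule.mem_iSup_of_mem χ (mem_wsp_one.mpr fun h => ?_)
    have : π (⁅(h : g), (⟨m, hm.1⟩ : ↥P)⁆ - χ h • ⟨m, hm.1⟩) = 0 :=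
      (LieSubmodule.Quotient.mk_eq_zero _).mpr (hPP' χ m hm h)
    rw [map_sub, LieModuleHom.map_lie, map_smul, sub_eq_zero] at this
    exact this
  obtain ⟨p, hp, hpm⟩ := key (hP m.2)
  rw [← show p = m from Subtype.ext hpm]
  exact hp

lemma inCatO_subquotient [IsLieAbelian ↥t] (P P' : LieSubmodule E g M)
    (hfg : ∃ s : Finset M, LieSubmodule.lieSpan E g (s : Set M) = P)
    (hb : IsLocBFinite E g b M)
    (hP : P.toSubmodule ≤ ⨆ χ, P.toSubmodule ⊓ gwsp E g t M χ)
    (hPP' : ∀ χ, ∀ m ∈ P.toSubmodule ⊓ gwsp E g t M χ, ∀ h : ↥t,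
      ⁅(h : g), m⁆ - χ h • m ∈ P') :
    InCatO E g t b (↥P ⧸ P'.comap P.incl) :=
  ⟨isFG_of_surjective _ (LieSubmodule.Quotient.surjective_mk' _) ((isFG_coe_iff P).mpr hfg),
    isDiagonalizable_subquotient P P' hP hPP',
    isLocBFinite_of_surjective _ (LieSubmodule.Quotient.surjective_mk' _)
      (isLocBFinite_coe P hb)⟩

lemma exists_filtration_of_inCatOInf [Module.Finite E g] [IsLieAbelian ↥t]
    (hroot : ⨆ α, rootSp E g t α = ⊤) (hM : InCatOInf E g t b M) :
    ∃ (n : ℕ) (c : ℕ → LieSubmodule E g M), Monotone c ∧ c 0 = ⊥ ∧ c n = ⊤ ∧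
      ∀ k < n, InCatO E g t b (filtQuot c k) := by
  obtain ⟨hfg, hs, hb⟩ := hM
  obtain ⟨n, hn⟩ := exists_nilpotent_part hroot hs
  obtain ⟨S, hS⟩ := Module.Finite.fg_top (R := E) (M := ↥t)
  let D (k : ℕ) : LieSubmodule E g M := (fun P => ⨆ i : S, P.map (n i))^[k] ⊤
  have hD (k : ℕ) : D (k + 1) = ⨆ i : S, (D k).map (n i) := Function.iterate_succ_apply' _ _ _
  have hDanti : Antitone D := by
    refine antitone_nat_of_succ_le fun k => ?_
    induction k with
    | zero => exact le_top
    | succ k ih =>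
      rw [hD (k + 1), hD k]
      exact iSup_mono fun i => LieSubmodule.map_mono (hD k ▸ ih)
  have hDfg (k : ℕ) : ∃ s : Finset M, LieSubmodule.lieSpan E g (s : Set M) = D k := by
    induction k with
    | zero => exact hfg
    | succ k ih => exact hD k ▸ exists_lieSpan_eq_iSup fun i => exists_lieSpan_eq_map _ ih
  have hDsplit (k : ℕ) : (D k).toSubmodule ≤ ⨆ χ, (D k).toSubmodule ⊓ gwsp E g t M χ := by
    induction k with
    | zero => simp [D, isESplit_iff.mp hs]
    | succ k ih =>
      nth_rw 1 [hD]
      rw [LieSubmodule.iSup_toSubmodule, iSup_le_iff]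
      intro i
      rw [LieSubmodule.toSubmodule_map]
      refine (Submodule.map_mono ih).trans ?_
      rw [Submodule.map_iSup]
      refine iSup_mono fun χ => ?_
      rintro _ ⟨m, hm, rfl⟩
      refine ⟨?_, map_mem_gwsp _ hm.2⟩
      rw [hD]
      exact (le_iSup (fun i : S => (D k).map (n i)) i) (LieSubmodule.mem_map_of_mem hm.1)
  have hDstep (k : ℕ) (χ : Module.Dual E ↥t) (m : M)
      (hm : m ∈ (D k).toSubmodule ⊓ gwsp E g t M χ) (h : ↥t) :
      ⁅(h : g), m⁆ - χ h • m ∈ D (k + 1) := by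
    have hspan : h ∈ Submodule.span E (S : Set ↥t) := hS ▸ Submodule.mem_top
    induction hspan using Submodule.span_induction with
    | mem h hh =>
      rw [← hn χ m hm.2, hD]
      exact (le_iSup (fun i : S => (D k).map (n i)) ⟨h, hh⟩) (LieSubmodule.mem_map_of_mem hm.1)
    | zero => simp
    | add h h' _ _ hh hh' =>
      convert add_mem hh hh' using 1
      simp [add_smul]
      abel
    | smul a h _ hh =>
      convert (D (k + 1)).smul_mem a hh using 1
      simp [smul_sub, mul_smul]
  obtain ⟨N, hN⟩ := exists_descending_eq_bot n S (nilpotent_part_commute hn hs)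
    (nilpotent_part_isNilpotent hn hs hfg) D hD
  refine ⟨N, fun k => D (N - k), fun i j hij => hDanti (Nat.sub_le_sub_left hij N), hN,
    by simp [D], fun k hk => ?_⟩
  refine inCatO_subquotient _ _ (hDfg _) hb (hDsplit _) ?_
  have : N - k = N - (k + 1) + 1 := by lia
  simp only [this]
  exact hDstep _

lemma exists_lieSpan_eq_of_subquotient {P P' : LieSubmodule E g M} (hle : P' ≤ P)
    (hP' : ∃ s : Finset M, LieSubmodule.lieSpan E g (s : Set M) = P')
    (hQ : IsFG E g (↥P ⧸ P'.comap P.incl)) :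
    ∃ s : Finset M, LieSubmodule.lieSpan E g (s : Set M) = P := by
  classical
  obtain ⟨s, hs⟩ := hP'
  obtain ⟨u, hu⟩ := hQ
  let π := LieSubmodule.Quotient.mk' (P'.comap P.incl)
  have hπ : Function.Surjective π := LieSubmodule.Quotient.surjective_mk' _
  let K := LieSubmodule.lieSpan E g
    ((s ∪ u.image fun q => (Function.surjInv hπ q).1 : Finset M) : Set M)
  refine ⟨_, le_antisymm (LieSubmodule.lieSpan_le.mpr ?_) (?_ : P ≤ K)⟩
  · intro m hm
    rcases Finset.mem_union.mp hm with hm | hm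
    · exact hle (hs ▸ LieSubmodule.subset_lieSpan hm)
    · obtain ⟨q, -, rfl⟩ := Finset.mem_image.mp hm
      exact (Function.surjInv hπ q).2
  · have hP'K : P' ≤ K := hs ▸ LieSubmodule.lieSpan_mono (by simp)
    have htop : ⊤ ≤ (K.comap P.incl).map π := by
      rw [← hu, LieSubmodule.lieSpan_le]
      intro q hq
      refine ⟨Function.surjInv hπ q, ?_, Function.surjInv_eq hπ q⟩
      exact LieSubmodule.subset_lieSpan
        (Finset.mem_union_right _ (Finset.mem_image_of_mem _ hq))
    intro m hm
    obtain ⟨p, hp, hpm⟩ := LieSubmodule.mem_map _ |>.mp (htop (LieSubmodule.mem_top (π ⟨m, hm⟩)))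
    have hsub : (⟨m, hm⟩ : ↥P) - p ∈ P'.comap P.incl := by
      rw [← LieSubmodule.Quotient.mk_eq_zero, map_sub, sub_eq_zero]
      exact hpm.symm
    have hmp : m - (p : M) ∈ K := hP'K hsub
    have hpK : (p : M) ∈ K := hp
    simpa only [sub_add_cancel] using add_mem hmp hpK

lemma exists_stable_of_subquotient [Module.Finite E g] {P P' : LieSubmodule E g M}
    (hP' : ∀ m ∈ P', ∃ W : Submodule E M, FiniteDimensional E ↥W ∧ m ∈ W ∧
      ∀ x : ↥b, ∀ w ∈ W, ⁅(x : g), w⁆ ∈ W)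
    (hQ : IsLocBFinite E g b (↥P ⧸ P'.comap P.incl)) :
    ∀ m ∈ P, ∃ W : Submodule E M, FiniteDimensional E ↥W ∧ m ∈ W ∧
      ∀ x : ↥b, ∀ w ∈ W, ⁅(x : g), w⁆ ∈ W := by
  intro m hm
  let π := LieSubmodule.Quotient.mk' (P'.comap P.incl)
  have hπ : Function.Surjective π := LieSubmodule.Quotient.surjective_mk' _
  obtain ⟨W, hW, hmW, hWb⟩ := hQ (π ⟨m, hm⟩)
  obtain ⟨U₀, hU₀, hU₀W⟩ := exists_fg_map_eq_of_surjective (π : ↥P →ₗ[E] _) hπ W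
    (Module.Finite.iff_fg.mp hW)
  let U := U₀ ⊔ Submodule.span E {⟨m, hm⟩}
  have hUW : U ≤ W.comap (π : ↥P →ₗ[E] _) :=
    sup_le (Submodule.map_le_iff_le_comap.mp hU₀W.le) (by simpa using hmW)
  let V := U.map P.toSubmodule.subtype
  have hV : V.FG := (hU₀.sup (Submodule.fg_span_singleton _)).map _
  let F := V ⊔ Submodule.map₂ (LieModule.toEnd E g M : g →ₗ[E] Module.End E M) b.toSubmodule V
  have hF : F.FG := hV.sup ((IsNoetherian.noetherian _).map₂ _ hV)
  have : FiniteDimensional E ↥V := Module.Finite.iff_fg.mpr hV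
  have : FiniteDimensional E ↥F := Module.Finite.iff_fg.mpr hF
  have hFP : FiniteDimensional E ↥(F ⊓ P'.toSubmodule) :=
    Submodule.finiteDimensional_of_le inf_le_left
  obtain ⟨Z, _, hFZ, hZ⟩ := exists_stable_ge_of_fg (Module.Finite.iff_fg.mp hFP)
    fun m hm => hP' m hm.2
  refine ⟨V ⊔ Z, inferInstance, Submodule.mem_sup_left ⟨⟨m, hm⟩, ?_, rfl⟩, fun x w hw => ?_⟩
  · exact Submodule.mem_sup_right (Submodule.mem_span_singleton_self _)
  obtain ⟨_, ⟨(u : ↥P), hu, rfl⟩, z, hz, rfl⟩ := Submodule.mem_sup.mp hw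
  rw [lie_add]
  refine add_mem ?_ (Submodule.mem_sup_right (hZ x z hz))
  have hxu : π ⁅(x : g), u⁆ ∈ W := by
    rw [LieModuleHom.map_lie]
    exact hWb x _ (hUW hu)
  rw [← hU₀W] at hxu
  obtain ⟨u', hu', huu'⟩ := hxu
  have hu'V : (u' : M) ∈ V := ⟨u', Submodule.mem_sup_left hu', rfl⟩
  have hsub : ⁅(x : g), (u : M)⁆ - u' ∈ F ⊓ P'.toSubmodule := by
    refine ⟨sub_mem (Submodule.mem_sup_right ?_) (Submodule.mem_sup_left hu'V), ?_⟩
    · exact Submodule.apply_mem_map₂ (LieModule.toEnd E g M : g →ₗ[E] Module.End E M) x.2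
        ⟨u, hu, rfl⟩
    · have : ⁅(x : g), u⁆ - u' ∈ P'.comap P.incl := by
        rw [← LieSubmodule.Quotient.mk_eq_zero, map_sub, sub_eq_zero]
        exact huu'.symm
      exact this
  have := add_mem (Submodule.mem_sup_right (hFZ hsub)) (Submodule.mem_sup_left (T := Z) hu'V)
  rwa [sub_add_cancel] at this

open Polynomial

lemma exists_aeval_prod_eq_zero_of_isDiagonalizable [IsLieAbelian ↥t]
    (hM : IsDiagonalizable E g t M) (h : ↥t) (m : M) :
    ∃ s : Multiset E,
      aeval (LieModule.toEnd E g M (h : g)) (s.map fun a => X - C a).prod m = 0 := by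
  have hm : m ∈ ⨆ χ, wsp E g t M 1 χ := isDiagonalizable_iff.mp hM ▸ Submodule.mem_top
  induction hm using Submodule.iSup_induction' with
  | zero => exact ⟨0, by simp⟩
  | add m m' _ _ hm hm' =>
    obtain ⟨s, hs⟩ := hm
    obtain ⟨s', hs'⟩ := hm'
    refine ⟨s + s', ?_⟩
    rw [Multiset.map_add, Multiset.prod_add, map_add]
    nth_rw 1 [mul_comm]
    simp only [map_mul, Module.End.mul_apply, hs, hs', map_zero, add_zero]
  | mem χ m hm => exact ⟨{χ h}, by simp [mem_wsp_one.mp hm h]⟩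

lemma exists_aeval_prod_eq_zero_of_subquotient [IsLieAbelian ↥t] {P P' : LieSubmodule E g M}
    (h : ↥t)
    (hP' : ∀ m ∈ P', ∃ s : Multiset E,
      aeval (LieModule.toEnd E g M (h : g)) (s.map fun a => X - C a).prod m = 0)
    (hQ : IsDiagonalizable E g t (↥P ⧸ P'.comap P.incl)) :
    ∀ m ∈ P, ∃ s : Multiset E,
      aeval (LieModule.toEnd E g M (h : g)) (s.map fun a => X - C a).prod m = 0 := by
  intro m hm
  let π := LieSubmodule.Quotient.mk' (P'.comap P.incl)
  obtain ⟨s, hs⟩ := exists_aeval_prod_eq_zero_of_isDiagonalizable hQ h (π ⟨m, hm⟩)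
  have hπs : π (aeval (LieModule.toEnd E g ↥P (h : g)) (s.map fun a => X - C a).prod ⟨m, hm⟩) = 0 :=
    (map_aeval_apply_of_intertwines (π : ↥P →ₗ[E] ↥P ⧸ P'.comap P.incl)
      (LieModule.toEnd E g ↥P (h : g)) (LieModule.toEnd E g (↥P ⧸ P'.comap P.incl) (h : g))
      (fun v => LieModuleHom.map_lie π _ _) _ _).trans hs
  have hmem := (LieSubmodule.Quotient.mk_eq_zero _).mp hπs
  have hcoe := map_aeval_apply_of_intertwines P.toSubmodule.subtype
    (LieModule.toEnd E g ↥P (h : g)) (LieModule.toEnd E g M (h : g)) (fun _ => rfl)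
    (s.map fun a => X - C a).prod ⟨m, hm⟩
  obtain ⟨s', hs'⟩ := hP' _ hmem
  refine ⟨s' + s, ?_⟩
  rw [Multiset.map_add, Multiset.prod_add, map_mul, Module.End.mul_apply]
  exact (congrArg _ hcoe.symm).trans hs'

lemma isESplit_of_exists_aeval_prod_eq_zero [IsLieAbelian ↥t] (htb : t ≤ b)
    (hb : IsLocBFinite E g b M)
    (h : ∀ (h : ↥t) (m : M), ∃ s : Multiset E,
      aeval (LieModule.toEnd E g M (h : g)) (s.map fun a => X - C a).prod m = 0) :
    IsESplit E g t M := by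
  rw [isESplit_iff, eq_top_iff]
  intro m _
  obtain ⟨W₀, hW₀, hm, hWb⟩ := hb m
  let W : LieSubmodule E ↥t M := { W₀ with lie_mem := fun {x w} hw => hWb ⟨x, htb x.2⟩ w hw }
  have : FiniteDimensional E ↥W := hW₀
  have hcoe (x : ↥t) (w : ↥W) : W.toSubmodule.subtype (LieModule.toEnd E ↥t ↥W x w) =
    LieModule.toEnd E g M (x : g) (W.toSubmodule.subtype w) := rfl
  have : LieModule.IsTriangularizable E ↥t ↥W := by
    refine ⟨fun x => eq_top_iff.mpr fun w _ => ?_⟩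
    obtain ⟨s, hs⟩ := h x w
    refine mem_iSup_maxGenEigenspace_of_aeval_prod_eq_zero _ s w ?_
    apply W.toSubmodule.injective_subtype
    rw [map_aeval_apply_of_intertwines _ _ _ (hcoe x), map_zero]
    exact hs
  have hw : (⟨m, hm⟩ : ↥W) ∈ ⨆ χ : LieModule.Weight E ↥t ↥W, LieModule.genWeightSpace ↥W χ := by
    rw [LieModule.iSup_genWeightSpace_eq_top']
    exact LieSubmodule.mem_top _
  rw [← LieSubmodule.mem_toSubmodule, LieSubmodule.iSup_toSubmodule] at hw
  have hle : ⨆ χ : LieModule.Weight E ↥t ↥W, (LieModule.genWeightSpace ↥W χ).toSubmodule ≤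
      (⨆ χ, gwsp E g t M χ).comap W.toSubmodule.subtype := by
    refine iSup_le fun χ w hw => ?_
    refine Submodule.mem_iSup_of_mem (LieModule.Weight.toLinear E ↥t ↥W χ) (mem_gwsp.mpr
      ⟨Module.finrank E ↥W, mem_wsp.mpr fun x => ?_⟩)
    have hx := (Module.End.mem_maxGenEigenspace _ _ _).mpr
      ((LieModule.mem_genWeightSpace _ _ _).mp hw x)
    rw [Module.End.maxGenEigenspace_eq_genEigenspace_finrank, Module.End.mem_genEigenspace_nat,
      LinearMap.mem_ker] at hx
    rw [← map_pow_apply_of_intertwines W.toSubmodule.subtype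
      (LieModule.toEnd E ↥t ↥W x - χ x • (1 : Module.End E ↥W)) _ (fun v => by simp; rfl), hx,
      map_zero]
  exact hle hw

lemma inCatOInf_of_filtration [Module.Finite E g] [IsLieAbelian ↥t] (htb : t ≤ b)
    (n : ℕ) (c : ℕ → LieSubmodule E g M) (hc : Monotone c) (h0 : c 0 = ⊥) (hn : c n = ⊤)
    (hQ : ∀ k < n, InCatO E g t b (filtQuot c k)) : InCatOInf E g t b M := by
  have hfg (k : ℕ) (hk : k ≤ n) :
      ∃ s : Finset M, LieSubmodule.lieSpan E g (s : Set M) = c k := by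
    induction k with
    | zero => exact ⟨∅, by simp [h0]⟩
    | succ k ih =>
      exact exists_lieSpan_eq_of_subquotient (hc k.le_succ) (ih (by lia)) (hQ k hk).1
  have hb (k : ℕ) (hk : k ≤ n) : ∀ m ∈ c k, ∃ W : Submodule E M, FiniteDimensional E ↥W ∧
      m ∈ W ∧ ∀ x : ↥b, ∀ w ∈ W, ⁅(x : g), w⁆ ∈ W := by
    induction k with
    | zero =>
      intro m hm
      rw [h0, LieSubmodule.mem_bot] at hm
      exact ⟨⊥, inferInstance, by simp [hm], by simp⟩
    | succ k ih => exact exists_stable_of_subquotient (ih (by lia)) (hQ k hk).2.2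
  have hs (h : ↥t) (k : ℕ) (hk : k ≤ n) : ∀ m ∈ c k, ∃ s : Multiset E,
      aeval (LieModule.toEnd E g M (h : g)) (s.map fun a => X - C a).prod m = 0 := by
    induction k with
    | zero =>
      intro m hm
      rw [h0, LieSubmodule.mem_bot] at hm
      exact ⟨0, by simp [hm]⟩
    | succ k ih => exact exists_aeval_prod_eq_zero_of_subquotient h (ih (by lia)) (hQ k hk).2.1
  have hmem (m : M) : m ∈ c n := hn ▸ LieSubmodule.mem_top m
  have hb' : IsLocBFinite E g b M := fun m => hb n le_rfl m (hmem m)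
  obtain ⟨s, hs'⟩ := hfg n le_rfl
  exact ⟨⟨s, hs'.trans hn⟩, isESplit_of_exists_aeval_prod_eq_zero htb hb'
    fun h m => hs h n le_rfl m (hmem m), hb'⟩

end LieModules

/-- a `U(g_E)`-module `M` belongs to `O^∞` if and only if there is a finite
filtration `0 = M_0 ⊆ M_1 ⊆ … ⊆ M_n = M` by `U(g_E)`-submodules all of whose successive
quotients `M_k/M_{k-1}` lie in category `O`. -/
theorem inCatOInf_iff_filtration_catO
    (E : Type) [Field E] [CharZero E]
    (g : Type) [LieRing g] [LieAlgebra E g] [Module.Finite E g]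
    (t b : LieSubalgebra E g)
    (htb : t ≤ b) (habel : IsLieAbelian ↥t)
    (Φ Φp : Finset (Module.Dual E ↥t))
    (hΦ0 : (0 : Module.Dual E ↥t) ∉ Φ)
    (hcartan : t.toSubmodule ⊔ (⨆ α ∈ Φ, rootSp E g t α) = ⊤)
    (hΦp : ∀ α, α ∈ Φp ↔ α ∈ Φ ∧ rootSp E g t α ≤ b.toSubmodule)
    (hborel : t.toSubmodule ⊔ (⨆ α ∈ Φp, rootSp E g t α) = b.toSubmodule)
    (hsplit : ∀ α ∈ Φ, α ∈ Φp ∨ -α ∈ Φp)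
    (M : Type) [AddCommGroup M] [Module E M] [LieRingModule g M] [LieModule E g M] :
    InCatOInf E g t b M ↔
      ∃ (n : ℕ) (c : ℕ → LieSubmodule E g M), Monotone c ∧ c 0 = ⊥ ∧ c n = ⊤ ∧
        ∀ k < n, InCatO E g t b (filtQuot c k) := by
  have hroot : ⨆ α, rootSp E g t α = ⊤ := eq_top_iff.mpr <| hcartan.ge.trans <|
    sup_le (toSubmodule_le_rootSp_zero.trans (le_iSup _ 0)) (iSup₂_le fun α _ => le_iSup _ α)
  refine ⟨exists_filtration_of_inCatOInf hroot, ?_⟩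
  rintro ⟨n, c, hc, h0, hn, hQ⟩
  exact inCatOInf_of_filtration htb n c hc h0 hn hQ

end PaperO
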